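/- arXiv:2410.20525 — 3 statements merged into one kernel-verified Lean document; each statement's English description precedes it below -/
import Mathlib

section
/- Let G be a directed polymatroidal network, let v ∈ V, and let x ∈ ℝ^{V∪E}. Write x⁺ = (max{x_i, 0})_{i∈V∪E} and x⁻ = (max{−x_i, 0})_{i∈V∪E}. Then for each a ∈ {x⁺, −x⁻}: ρ̂⁺_v(A⁺(a,v)) ≤ ρ̂⁺_v(A⁺(x,v)), ρ̂⁻_v(A⁻(a,v)) ≤ ρ̂⁻_v(A⁻(x,v)), ρ̂⁺_v(B⁺(a,v)) ≤ ρ̂⁺_v(B⁺(x,v)), and ρ̂⁻_v(B⁻(a,v)) ≤ ρ̂⁻_v(B⁻(x,v)). -/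
open MeasureTheory

/-- Lovász extension of the set function `f`, with ground set `D`,
evaluated at the (nonnegative) vector `x`. -/
noncomputable def lovOn {E : Type*} (f : Set E → ℝ) (D : Set E) (x : E → ℝ) : ℝ :=
  ∫ θ in Set.Ioi (0 : ℝ), f (D ∩ {e | θ ≤ x e})

/-- A directed polymatroidal network on vertex type `V` and edge type `E`. -/
structure PolyNet (V E : Type*) [Fintype V] [Fintype E] where
  tail : E → V
  head : E → V
  w : V → ℝ
  w_nonneg : ∀ v, 0 ≤ w v
  ρp : V → Set E → ℝ
  ρm : V → Set E → ℝ
  ρp_nonneg : ∀ v A, 0 ≤ ρp v A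
  ρm_nonneg : ∀ v A, 0 ≤ ρm v A
  ρp_empty : ∀ v, ρp v ∅ = 0
  ρm_empty : ∀ v, ρm v ∅ = 0
  ρp_mono : ∀ v A B, A ⊆ B → B ⊆ {e | tail e = v} → ρp v A ≤ ρp v B
  ρm_mono : ∀ v A B, A ⊆ B → B ⊆ {e | head e = v} → ρm v A ≤ ρm v B
  ρp_submod : ∀ v A B, A ⊆ {e | tail e = v} → B ⊆ {e | tail e = v} →
    ρp v (A ∪ B) + ρp v (A ∩ B) ≤ ρp v A + ρp v B
  ρm_submod : ∀ v A B, A ⊆ {e | head e = v} → B ⊆ {e | head e = v} →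
    ρm v (A ∪ B) + ρm v (A ∩ B) ≤ ρm v A + ρm v B

namespace PolyNet

variable {V E : Type*} [Fintype V] [Fintype E] (N : PolyNet V E)

/-- The set of edges leaving `v`. -/
def outE (v : V) : Set E := {e | N.tail e = v}

/-- The set of edges entering `v`. -/
def inE (v : V) : Set E := {e | N.head e = v}

/-- The degree of a vertex. -/
noncomputable def deg (v : V) : ℝ := N.ρp v (N.outE v) + N.ρm v (N.inE v)

/-- The volume of a set of vertices. -/
noncomputable def vol (S : Set V) : ℝ := ∑ v, S.indicator N.deg v

/-- The total weight of a set of vertices. -/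
noncomputable def wsum (S : Set V) : ℝ := ∑ v, S.indicator N.w v

/-- An assignment `g` of (cut) edges to vertices is valid on `F` if every edge of `F` is
assigned to one of its endpoints. -/
def valid (F : Set E) (g : E → V) : Prop := ∀ e ∈ F, g e = N.tail e ∨ g e = N.head e

/-- The cost of the cut `F` under the assignment `g`. -/
noncomputable def cutCost (F : Set E) (g : E → V) : ℝ :=
  ∑ v, (N.ρp v (N.outE v ∩ F ∩ {e | g e = v}) + N.ρm v (N.inE v ∩ F ∩ {e | g e = v}))

/-- The cost of the cut `F`: minimum over valid assignments. -/
noncomputable def cut (F : Set E) : ℝ :=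
  sInf {c | ∃ g : E → V, N.valid F g ∧ c = N.cutCost F g}

/-- Edges from `S` to its complement. -/
def dplus (S : Set V) : Set E := {e | N.tail e ∈ S ∧ N.head e ∉ S}

/-- Edges from the complement of `S` into `S`. -/
def dminus (S : Set V) : Set E := {e | N.tail e ∉ S ∧ N.head e ∈ S}

/-- The (directed) value of the cut induced by `S`. -/
noncomputable def cutval (S : Set V) : ℝ := min (N.cut (N.dplus S)) (N.cut (N.dminus S))

/-- The symmetric value of the cut induced by `S`. -/
noncomputable def symcutval (S : Set V) : ℝ := N.cut (N.dplus S) + N.cut (N.dminus S)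

/-- The Rayleigh quotient `R⁺`. -/
noncomputable def Rp (x : V ⊕ E → ℝ) : ℝ :=
  (∑ v, (lovOn (N.ρp v) (N.outE v) (fun e => (max 0 (x (Sum.inl v) - x (Sum.inr e)))^2)
       + lovOn (N.ρm v) (N.inE v) (fun e => (max 0 (x (Sum.inr e) - x (Sum.inl v)))^2)))
  / ∑ v, N.deg v * (x (Sum.inl v))^2

/-- The Rayleigh quotient `R⁻`. -/
noncomputable def Rm (x : V ⊕ E → ℝ) : ℝ :=
  (∑ v, (lovOn (N.ρp v) (N.outE v) (fun e => (max 0 (x (Sum.inr e) - x (Sum.inl v)))^2)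
       + lovOn (N.ρm v) (N.inE v) (fun e => (max 0 (x (Sum.inl v) - x (Sum.inr e)))^2)))
  / ∑ v, N.deg v * (x (Sum.inl v))^2

/-- The Rayleigh quotient `R`. -/
noncomputable def Ray (x : V ⊕ E → ℝ) : ℝ := min (N.Rp x) (N.Rm x)

/-- The symmetric Rayleigh quotient `R̄`. -/
noncomputable def RaySym (x : V ⊕ E → ℝ) : ℝ := N.Rp x + N.Rm x

/-- The spectral gap `γ₂` of a polymatroidal network. -/
noncomputable def gap : ℝ :=
  sInf {r | ∃ x : V ⊕ E → ℝ, (∑ v, N.deg v * x (Sum.inl v)) = 0 ∧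
    (0 < ∑ v, N.deg v * (x (Sum.inl v))^2) ∧ r = N.Ray x}

end PolyNet

/-- The superlevel-set integrand of the Lovász extension of a normalized monotone set function is
integrable on the positive half-line. -/
theorem integrableOn_lovOn_integrand {E : Type*} [Finite E] {f : Set E → ℝ} {D : Set E}
    (hempty : f ∅ = 0) (hmono : ∀ A B, A ⊆ B → B ⊆ D → f A ≤ f B) (y : E → ℝ) :
    IntegrableOn (fun θ : ℝ => f (D ∩ {e | θ ≤ y e})) (Set.Ioi 0) := by
  have hanti : Antitone fun θ : ℝ => f (D ∩ {e | θ ≤ y e}) := fun s t hst =>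
    hmono _ _ (Set.inter_subset_inter_right D fun _ he => hst.trans he) Set.inter_subset_left
  obtain ⟨M, hM⟩ := (Set.finite_range y).bddAbove
  have hIcc : IntegrableOn (fun θ : ℝ => f (D ∩ {e | θ ≤ y e})) (Set.Icc 0 M) :=
    (hanti.antitoneOn _).integrableOn_isCompact isCompact_Icc
  refine hIcc.of_forall_sdiff_eq_zero measurableSet_Ioi fun θ hθ => ?_
  have hMθ : M < θ := lt_of_not_ge fun h => hθ.2 ⟨hθ.1.le, h⟩
  have hset : D ∩ {e | θ ≤ y e} = ∅ :=
    Set.eq_empty_of_forall_notMem fun e he =>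
      (hMθ.trans_le he.2).not_ge (hM (Set.mem_range_self e))
  simp only [hset, hempty]

/-- The Lovász extension of a normalized monotone set function is monotone. -/
theorem lovOn_mono {E : Type*} [Finite E] {f : Set E → ℝ} {D : Set E}
    (hempty : f ∅ = 0) (hmono : ∀ A B, A ⊆ B → B ⊆ D → f A ≤ f B) {y z : E → ℝ}
    (hyz : ∀ e, y e ≤ z e) : lovOn f D y ≤ lovOn f D z :=
  integral_mono (integrableOn_lovOn_integrand hempty hmono y)
    (integrableOn_lovOn_integrand hempty hmono z) fun _ =>
    hmono _ _ (Set.inter_subset_inter_right D fun e he => le_trans he (hyz e))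
      Set.inter_subset_left

/-- Taking the positive part `x⁺` or the negated negative part `−x⁻` of a
vector does not increase any of the Lovász-extension terms of the Rayleigh
quotients. -/
theorem lovasz_pos_neg_part_le {V E : Type*} [Fintype V] [Fintype E] (N : PolyNet V E)
    (v : V) (x : V ⊕ E → ℝ) (a : V ⊕ E → ℝ)
    (ha : (a = fun i => max (x i) 0) ∨ (a = fun i => -(max (-(x i)) 0))) :
    lovOn (N.ρp v) (N.outE v) (fun e => (max 0 (a (Sum.inl v) - a (Sum.inr e)))^2)
      ≤ lovOn (N.ρp v) (N.outE v) (fun e => (max 0 (x (Sum.inl v) - x (Sum.inr e)))^2) ∧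
    lovOn (N.ρm v) (N.inE v) (fun e => (max 0 (a (Sum.inl v) - a (Sum.inr e)))^2)
      ≤ lovOn (N.ρm v) (N.inE v) (fun e => (max 0 (x (Sum.inl v) - x (Sum.inr e)))^2) ∧
    lovOn (N.ρp v) (N.outE v) (fun e => (max 0 (a (Sum.inr e) - a (Sum.inl v)))^2)
      ≤ lovOn (N.ρp v) (N.outE v) (fun e => (max 0 (x (Sum.inr e) - x (Sum.inl v)))^2) ∧
    lovOn (N.ρm v) (N.inE v) (fun e => (max 0 (a (Sum.inr e) - a (Sum.inl v)))^2)
      ≤ lovOn (N.ρm v) (N.inE v) (fun e => (max 0 (x (Sum.inr e) - x (Sum.inl v)))^2) := by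
  have hsub : ∀ i j, max 0 (a i - a j) ≤ max 0 (x i - x j) := by
    intro i j
    rcases ha with rfl | rfl <;> grind
  have hsq : ∀ i j, (max 0 (a i - a j)) ^ 2 ≤ (max 0 (x i - x j)) ^ 2 := fun i j =>
    pow_le_pow_left₀ (le_max_left _ _) (hsub i j) 2
  exact ⟨lovOn_mono (N.ρp_empty v) (N.ρp_mono v) fun _ => hsq _ _,
    lovOn_mono (N.ρm_empty v) (N.ρm_mono v) fun _ => hsq _ _,
    lovOn_mono (N.ρp_empty v) (N.ρp_mono v) fun _ => hsq _ _,
    lovOn_mono (N.ρm_empty v) (N.ρm_mono v) fun _ => hsq _ _⟩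
end

section
/- Let G be a directed polymatroidal network and let z ∈ ℝ≥0^{V∪E}. Then ∑_{v∈V} ρ̂⁺_v((max{0, z_v² − z_e²})_{e∈δ⁺(v)}) ≤ 2·∑_{v∈V} ρ̂⁺_v(A⁺(z,v)) + 4·√(∑_{v∈V} ρ̂⁺_v(A⁺(z,v)))·√(∑_{v∈V} deg_v z_v²), and likewise ∑_{v∈V} ρ̂⁻_v((max{0, z_e² − z_v²})_{e∈δ⁻(v)}) ≤ 2·∑_{v∈V} ρ̂⁻_v(B⁻(z,v)) + 4·√(∑_{v∈V} ρ̂⁻_v(B⁻(z,v)))·√(∑_{v∈V} deg_v z_v²). -/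
open MeasureTheory

section LovaszExtension

variable {E : Type*} {f : Set E → ℝ} {D : Set E}

lemma antitone_level (hmono : ∀ A B, A ⊆ B → B ⊆ D → f A ≤ f B) (x : E → ℝ) :
    Antitone fun θ : ℝ => f (D ∩ {e | θ ≤ x e}) := fun _ _ h =>
  hmono _ _ (Set.inter_subset_inter_right _ fun _ he => h.trans he) Set.inter_subset_left

lemma integrableOn_level_Ioi [Finite E] (hempty : f ∅ = 0)
    (hmono : ∀ A B, A ⊆ B → B ⊆ D → f A ≤ f B) (x : E → ℝ) (a : ℝ) :
    IntegrableOn (fun θ : ℝ => f (D ∩ {e | θ ≤ x e})) (Set.Ioi a) := by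
  obtain ⟨M, hM⟩ := (Set.finite_range x).bddAbove
  have hIcc : IntegrableOn (fun θ : ℝ => f (D ∩ {e | θ ≤ x e})) (Set.Icc a (max a M)) :=
    ((antitone_level hmono x).antitoneOn _).integrableOn_isCompact isCompact_Icc
  have hIoi : IntegrableOn (fun θ : ℝ => f (D ∩ {e | θ ≤ x e})) (Set.Ioi (max a M)) := by
    refine integrableOn_zero.congr_fun (fun θ hθ => ?_) measurableSet_Ioi
    have hlevel : D ∩ {e | θ ≤ x e} = ∅ := by
      refine Set.eq_empty_of_forall_notMem fun e he => ?_
      have hxM : x e ≤ M := hM ⟨e, rfl⟩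
      exact absurd ((max_lt_iff.1 hθ).2.trans_le he.2) hxM.not_gt
    simp [hlevel, hempty]
  refine (hIcc.union hIoi).mono_set fun θ hθ => ?_
  rcases le_or_gt θ (max a M) with h | h
  · exact Or.inl ⟨le_of_lt hθ, h⟩
  · exact Or.inr h

lemma lovOn_nonneg (hnonneg : ∀ A, 0 ≤ f A) (x : E → ℝ) : 0 ≤ lovOn f D x :=
  integral_nonneg fun _ => hnonneg _

lemma lovOn_const_mul (f : Set E → ℝ) (D : Set E) (x : E → ℝ) {c : ℝ} (hc : 0 < c) :
    lovOn f D (fun e => c * x e) = c * lovOn f D x := by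
  have h := integral_comp_mul_left_Ioi' (fun θ : ℝ => f (D ∩ {e | θ ≤ c * x e})) 0 hc
  simpa [lovOn, mul_le_mul_iff_right₀ hc] using h.symm

/-- An additive error `s` in the argument costs at most `s * f D`. -/
lemma lovOn_le_mul_add [Finite E] (hempty : f ∅ = 0)
    (hmono : ∀ A B, A ⊆ B → B ⊆ D → f A ≤ f B) {x y : E → ℝ} {s : ℝ} (hs : 0 ≤ s)
    (hxy : ∀ e, x e ≤ s + y e) : lovOn f D x ≤ s * f D + lovOn f D y := by
  have hsplit : lovOn f D x = (∫ θ in Set.Ioc 0 s, f (D ∩ {e | θ ≤ x e})) +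
      ∫ θ in Set.Ioi s, f (D ∩ {e | θ ≤ x e}) := by
    rw [lovOn, ← Set.Ioc_union_Ioi_eq_Ioi hs]
    exact setIntegral_union (Set.Ioc_disjoint_Ioi le_rfl) measurableSet_Ioi
      ((integrableOn_level_Ioi hempty hmono x 0).mono_set Set.Ioc_subset_Ioi_self)
      (integrableOn_level_Ioi hempty hmono x s)
  have hshift : ∫ θ in Set.Ioi s, f (D ∩ {e | θ ≤ x e}) =
      ∫ θ in Set.Ioi (0 : ℝ), f (D ∩ {e | θ ≤ x e - s}) := by
    have h := (measurePreserving_add_right volume s).setIntegral_preimage_emb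
      (measurableEmbedding_addRight s) (fun θ => f (D ∩ {e | θ ≤ x e})) (Set.Ioi s)
    simpa [le_sub_iff_add_le] using h.symm
  have hlow : ∫ θ in Set.Ioc 0 s, f (D ∩ {e | θ ≤ x e}) ≤ s * f D := by
    calc ∫ θ in Set.Ioc 0 s, f (D ∩ {e | θ ≤ x e}) ≤ ∫ _ in Set.Ioc 0 s, f D :=
          setIntegral_mono
            ((integrableOn_level_Ioi hempty hmono x 0).mono_set Set.Ioc_subset_Ioi_self)
            (integrableOn_const (by simp)) fun _ => hmono _ _ Set.inter_subset_left subset_rfl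
      _ = s * f D := by simp [hs]
  have hhigh : ∫ θ in Set.Ioi (0 : ℝ), f (D ∩ {e | θ ≤ x e - s}) ≤ lovOn f D y := by
    refine setIntegral_mono (integrableOn_level_Ioi hempty hmono _ 0)
      (integrableOn_level_Ioi hempty hmono y 0) fun θ => ?_
    refine hmono _ _ (Set.inter_subset_inter_right _ fun e he => ?_) Set.inter_subset_left
    exact le_trans he (sub_le_iff_le_add'.2 (hxy e))
  rw [hsplit, hshift]
  exact add_le_add hlow hhigh

lemma lovOn_le_of_le_sq_add [Finite E] (hempty : f ∅ = 0)
    (hmono : ∀ A B, A ⊆ B → B ⊆ D → f A ≤ f B) {x d : E → ℝ} {a t : ℝ} (ht : 0 < t)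
    (hx : ∀ e, x e ≤ d e ^ 2 + 2 * a * d e) :
    lovOn f D x ≤ (1 + t) * lovOn f D (fun e => d e ^ 2) + f D * a ^ 2 / t := by
  have h := lovOn_le_mul_add (f := f) (D := D) hempty hmono (x := x)
    (y := fun e => (1 + t) * d e ^ 2) (s := a ^ 2 / t) (by positivity) fun e => by
      have hamgm : a ^ 2 / t + t * d e ^ 2 - 2 * a * d e = (a - t * d e) ^ 2 / t := by
        field_simp
        ring
      have hnonneg : 0 ≤ (a - t * d e) ^ 2 / t := by positivity
      linarith [hx e]
  rw [lovOn_const_mul f D _ (by linarith)] at h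
  calc lovOn f D x ≤ _ := h
    _ = _ := by ring

end LovaszExtension

lemma le_of_forall_le_add_div {L Q W : ℝ} (hQ : 0 ≤ Q) (hW : 0 ≤ W)
    (h : ∀ t : ℝ, 0 < t → L ≤ (1 + t) * Q + W / t) :
    L ≤ 2 * Q + 4 * Real.sqrt Q * Real.sqrt W := by
  rcases hW.eq_or_lt with rfl | hW
  · have h1 := h 1 one_pos
    simp only [zero_div, Real.sqrt_zero, mul_zero] at h1 ⊢
    linarith
  rcases hQ.eq_or_lt with rfl | hQ
  · by_contra! hL
    simp only [Real.sqrt_zero, mul_zero, zero_mul, add_zero] at hL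
    have h1 := h (2 * W / L) (by positivity)
    have h2 : W / (2 * W / L) = L / 2 := by field_simp
    rw [h2] at h1
    linarith
  · have hq := Real.sqrt_pos.2 hQ
    have hw := Real.sqrt_pos.2 hW
    have h1 := h (Real.sqrt W / Real.sqrt Q) (by positivity)
    have h2 : (1 + Real.sqrt W / Real.sqrt Q) * Q = Q + Real.sqrt Q * Real.sqrt W := by
      nth_rewrite 2 [← Real.sq_sqrt hQ.le]
      nth_rewrite 3 [← Real.sq_sqrt hQ.le]
      field_simp
    have h3 : W / (Real.sqrt W / Real.sqrt Q) = Real.sqrt Q * Real.sqrt W := by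
      nth_rewrite 1 [← Real.sq_sqrt hW.le]
      field_simp
    rw [h2, h3] at h1
    nlinarith [mul_pos hq hw]

lemma sum_lovOn_le {V E : Type*} [Fintype V] [Finite E] {f : V → Set E → ℝ} {D : V → Set E}
    (hnonneg : ∀ v A, 0 ≤ f v A) (hempty : ∀ v, f v ∅ = 0)
    (hmono : ∀ v A B, A ⊆ B → B ⊆ D v → f v A ≤ f v B) {x d : V → E → ℝ} {a w : V → ℝ}
    (hw : ∀ v, f v (D v) ≤ w v) (hx : ∀ v e, x v e ≤ d v e ^ 2 + 2 * a v * d v e) :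
    ∑ v, lovOn (f v) (D v) (x v) ≤ 2 * (∑ v, lovOn (f v) (D v) fun e => d v e ^ 2) +
      4 * Real.sqrt (∑ v, lovOn (f v) (D v) fun e => d v e ^ 2) *
        Real.sqrt (∑ v, w v * a v ^ 2) := by
  refine le_of_forall_le_add_div (Finset.sum_nonneg fun v _ => lovOn_nonneg (hnonneg v) _)
    (Finset.sum_nonneg fun v _ => mul_nonneg ((hnonneg v _).trans (hw v)) (sq_nonneg _))
    fun t ht => ?_
  rw [Finset.mul_sum, Finset.sum_div, ← Finset.sum_add_distrib]
  refine Finset.sum_le_sum fun v _ =>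
    (lovOn_le_of_le_sq_add (hempty v) (hmono v) ht (hx v)).trans ?_
  gcongr
  exact hw v

/-- Cauchy–Schwarz style bound: the Lovász extension applied to differences of
squares is controlled by the squared-difference terms, for nonnegative `z`. -/
theorem lovasz_cs_bound {V E : Type*} [Fintype V] [Fintype E] (N : PolyNet V E)
    (z : V ⊕ E → ℝ) (hz : ∀ i, 0 ≤ z i) :
    (∑ v, lovOn (N.ρp v) (N.outE v)
        (fun e => max 0 ((z (Sum.inl v))^2 - (z (Sum.inr e))^2)))
      ≤ 2 * (∑ v, lovOn (N.ρp v) (N.outE v)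
              (fun e => (max 0 (z (Sum.inl v) - z (Sum.inr e)))^2))
        + 4 * Real.sqrt (∑ v, lovOn (N.ρp v) (N.outE v)
              (fun e => (max 0 (z (Sum.inl v) - z (Sum.inr e)))^2))
            * Real.sqrt (∑ v, N.deg v * (z (Sum.inl v))^2) ∧
    (∑ v, lovOn (N.ρm v) (N.inE v)
        (fun e => max 0 ((z (Sum.inr e))^2 - (z (Sum.inl v))^2)))
      ≤ 2 * (∑ v, lovOn (N.ρm v) (N.inE v)
              (fun e => (max 0 (z (Sum.inr e) - z (Sum.inl v)))^2))
        + 4 * Real.sqrt (∑ v, lovOn (N.ρm v) (N.inE v)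
              (fun e => (max 0 (z (Sum.inr e) - z (Sum.inl v)))^2))
            * Real.sqrt (∑ v, N.deg v * (z (Sum.inl v))^2) := by
  constructor
  · refine sum_lovOn_le N.ρp_nonneg N.ρp_empty N.ρp_mono
      (fun v => le_add_of_nonneg_right (N.ρm_nonneg v _)) fun v e => ?_
    have hv := hz (Sum.inl v)
    rcases max_cases 0 (z (Sum.inl v) - z (Sum.inr e)) with ⟨h, h'⟩ | ⟨h, h'⟩ <;>
      rw [h] <;> refine max_le ?_ ?_ <;> nlinarith [hz (Sum.inr e)]
  · refine sum_lovOn_le N.ρm_nonneg N.ρm_empty N.ρm_mono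
      (fun v => le_add_of_nonneg_left (N.ρp_nonneg v _)) fun v e => ?_
    have hv := hz (Sum.inl v)
    rcases max_cases 0 (z (Sum.inr e) - z (Sum.inl v)) with ⟨h, h'⟩ | ⟨h, h'⟩ <;>
      rw [h] <;> refine max_le ?_ ?_ <;> nlinarith [hz (Sum.inr e)]
end

section
/- Let G = (V, E) be a finite simple graph with at least two vertices and vertex weights w : V → ℝ>0 satisfying w_v ≤ (1/4)·∑_{u∈V} w_u for every v ∈ V, and let H be the associated hypergraph with hyperedges e_v = {v} ∪ N(v) of weight w'(e_v) = w_v for each v ∈ V. Then (1/5)·Φ^V_G ≤ ψ_H ≤ Φ^V_G. -/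
open scoped BigOperators

namespace VertexExpansion

variable {V : Type*} [Fintype V]

/-- Inner boundary of `S`: vertices of `S` with a neighbour outside `S`. -/
def Nin (G : SimpleGraph V) (S : Set V) : Set V :=
  {v | v ∈ S ∧ ∃ u, G.Adj v u ∧ u ∉ S}

/-- Outer boundary of `S`: vertices outside `S` with a neighbour in `S`. -/
def Nout (G : SimpleGraph V) (S : Set V) : Set V :=
  {v | v ∉ S ∧ ∃ u, G.Adj v u ∧ u ∈ S}

/-- Total weight of a set of vertices. -/
noncomputable def wsum (w : V → ℝ) (S : Set V) : ℝ := ∑ v, S.indicator w v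

/-- The symmetric vertex expansion of `S`. -/
noncomputable def phiV (G : SimpleGraph V) (w : V → ℝ) (S : Set V) : ℝ :=
  wsum w (Nin G S ∪ Nout G S) / min (wsum w S) (wsum w Sᶜ)

/-- The symmetric vertex expansion of the graph. -/
noncomputable def PhiV (G : SimpleGraph V) (w : V → ℝ) : ℝ :=
  sInf {r | ∃ S : Set V, S.Nonempty ∧ S ≠ Set.univ ∧ r = phiV G w S}

/-- The hyperedge `e_v = {v} ∪ N(v)` of the associated hypergraph. -/
def hedge (G : SimpleGraph V) (v : V) : Set V := insert v (G.neighborSet v)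

/-- The hypergraph conductance `ψ_H(S)` of the associated hypergraph `H`, whose
hyperedges are `e_v = {v} ∪ N(v)` with weight `w v`. -/
noncomputable def psiH (G : SimpleGraph V) (w : V → ℝ) (S : Set V) : ℝ :=
  (∑ v, Set.indicator {v | (hedge G v ∩ S).Nonempty ∧ (hedge G v ∩ Sᶜ).Nonempty} w v) /
    min (∑ v, Set.indicator {v | (hedge G v ∩ S).Nonempty} w v)
        (∑ v, Set.indicator {v | (hedge G v ∩ Sᶜ).Nonempty} w v)

/-- The hypergraph conductance of the associated hypergraph. -/
noncomputable def PsiH (G : SimpleGraph V) (w : V → ℝ) : ℝ :=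
  sInf {r | ∃ S : Set V, S.Nonempty ∧ S ≠ Set.univ ∧ r = psiH G w S}

end VertexExpansion

namespace VertexExpansion

lemma setOf_hedge_inter_nonempty {V : Type*} (G : SimpleGraph V) (S : Set V) :
    {v | (hedge G v ∩ S).Nonempty} = S ∪ Nout G S := by
  ext v
  simp only [hedge, Nout, Set.Nonempty, Set.mem_inter_iff, Set.mem_insert_iff,
    SimpleGraph.mem_neighborSet, Set.mem_ofPred_eq, Set.mem_union]
  grind

lemma Nout_compl {V : Type*} (G : SimpleGraph V) (S : Set V) : Nout G Sᶜ = Nin G S := by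
  ext v
  simp [Nout, Nin]

lemma setOf_hedge_cut {V : Type*} (G : SimpleGraph V) (S : Set V) :
    {v | (hedge G v ∩ S).Nonempty ∧ (hedge G v ∩ Sᶜ).Nonempty} = Nin G S ∪ Nout G S := by
  rw [Set.ofPred_and, setOf_hedge_inter_nonempty, setOf_hedge_inter_nonempty, Nout_compl]
  ext v
  simp only [Nin, Nout, Set.mem_inter_iff, Set.mem_union, Set.mem_ofPred_eq, Set.mem_compl_iff]
  by_cases hv : v ∈ S <;> simp [hv]

section

variable {V : Type*} [Fintype V] {G : SimpleGraph V} {w : V → ℝ} {S T : Set V}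

lemma wsum_mono (hw : ∀ v, 0 < w v) (h : S ⊆ T) : wsum w S ≤ wsum w T :=
  Finset.sum_le_sum fun v _ =>
    Set.indicator_le_indicator_of_subset h (fun v => (hw v).le) v

lemma wsum_nonneg (hw : ∀ v, 0 < w v) (S : Set V) : 0 ≤ wsum w S :=
  Finset.sum_nonneg fun v _ => Set.indicator_nonneg (fun v _ => (hw v).le) v

lemma wsum_pos (hw : ∀ v, 0 < w v) (hS : S.Nonempty) : 0 < wsum w S := by
  obtain ⟨v, hv⟩ := hS
  refine Finset.sum_pos' (fun u _ => Set.indicator_nonneg (fun u _ => (hw u).le) u)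
    ⟨v, Finset.mem_univ v, ?_⟩
  rw [Set.indicator_of_mem hv]
  exact hw v

lemma wsum_union_le (hw : ∀ v, 0 < w v) (S T : Set V) :
    wsum w (S ∪ T) ≤ wsum w S + wsum w T := by
  unfold wsum
  rw [← Finset.sum_add_distrib]
  refine Finset.sum_le_sum fun v _ => ?_
  have := hw v
  by_cases hS : v ∈ S <;> by_cases hT : v ∈ T <;> simp [hS, hT, this.le]

lemma wsum_add_wsum_compl (w : V → ℝ) (S : Set V) : wsum w S + wsum w Sᶜ = ∑ v, w v := by
  unfold wsum
  rw [← Finset.sum_add_distrib]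
  exact Finset.sum_congr rfl fun v _ => Set.indicator_self_add_compl_apply S w v

lemma psiH_eq (G : SimpleGraph V) (w : V → ℝ) (S : Set V) :
    psiH G w S = wsum w (Nin G S ∪ Nout G S) /
      min (wsum w (S ∪ Nout G S)) (wsum w (Sᶜ ∪ Nin G S)) := by
  unfold psiH
  rw [setOf_hedge_cut, setOf_hedge_inter_nonempty, setOf_hedge_inter_nonempty, Nout_compl]
  rfl

lemma min_wsum_pos (hw : ∀ v, 0 < w v) (hS : S.Nonempty) (hS' : S ≠ Set.univ) :
    0 < min (wsum w S) (wsum w Sᶜ) :=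
  lt_min (wsum_pos hw hS) (wsum_pos hw (Set.nonempty_compl.2 hS'))

lemma min_wsum_le_min_wsum_union (hw : ∀ v, 0 < w v) (G : SimpleGraph V) (S : Set V) :
    min (wsum w S) (wsum w Sᶜ) ≤
      min (wsum w (S ∪ Nout G S)) (wsum w (Sᶜ ∪ Nin G S)) :=
  min_le_min (wsum_mono hw Set.subset_union_left) (wsum_mono hw Set.subset_union_left)

lemma min_wsum_union_le (hw : ∀ v, 0 < w v) (G : SimpleGraph V) (S : Set V) :
    min (wsum w (S ∪ Nout G S)) (wsum w (Sᶜ ∪ Nin G S)) ≤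
      min (wsum w S) (wsum w Sᶜ) + wsum w (Nin G S ∪ Nout G S) := by
  rw [← min_add_add_right]
  refine min_le_min ((wsum_union_le hw _ _).trans ?_) ((wsum_union_le hw _ _).trans ?_)
  · gcongr
    exact wsum_mono hw Set.subset_union_right
  · gcongr
    exact wsum_mono hw Set.subset_union_left

lemma phiV_nonneg (hw : ∀ v, 0 < w v) (G : SimpleGraph V) (S : Set V) : 0 ≤ phiV G w S :=
  div_nonneg (wsum_nonneg hw _) (le_min (wsum_nonneg hw _) (wsum_nonneg hw _))

lemma psiH_nonneg (hw : ∀ v, 0 < w v) (G : SimpleGraph V) (S : Set V) : 0 ≤ psiH G w S := by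
  rw [psiH_eq]
  exact div_nonneg (wsum_nonneg hw _) (le_min (wsum_nonneg hw _) (wsum_nonneg hw _))

lemma PhiV_le_phiV (hw : ∀ v, 0 < w v) (hS : S.Nonempty) (hS' : S ≠ Set.univ) :
    PhiV G w ≤ phiV G w S :=
  csInf_le ⟨0, by rintro _ ⟨S, -, -, rfl⟩; exact phiV_nonneg hw G S⟩ ⟨S, hS, hS', rfl⟩

lemma PsiH_le_psiH (hw : ∀ v, 0 < w v) (hS : S.Nonempty) (hS' : S ≠ Set.univ) :
    PsiH G w ≤ psiH G w S :=
  csInf_le ⟨0, by rintro _ ⟨S, -, -, rfl⟩; exact psiH_nonneg hw G S⟩ ⟨S, hS, hS', rfl⟩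

lemma psiH_le_phiV (hw : ∀ v, 0 < w v) (hS : S.Nonempty) (hS' : S ≠ Set.univ) :
    psiH G w S ≤ phiV G w S := by
  rw [psiH_eq]
  exact div_le_div_of_nonneg_left (wsum_nonneg hw _) (min_wsum_pos hw hS hS')
    (min_wsum_le_min_wsum_union hw G S)

/-- If no vertex carries more than a quarter of the total weight, then some set and its complement
both carry at least a quarter. -/
lemma exists_quarter_le_min_wsum (hw : ∀ v, 0 < w v)
    (hsmall : ∀ v, w v ≤ (1 / 4) * ∑ u, w u) :
    ∃ T : Set V, (1 / 4) * ∑ u, w u ≤ min (wsum w T) (wsum w Tᶜ) := by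
  have htot : 0 ≤ ∑ u, w u := Finset.sum_nonneg fun v _ => (hw v).le
  obtain ⟨T, hT⟩ := (Set.toFinite {T : Set V | wsum w T ≤ (3 / 4) * ∑ u, w u}).exists_maximal
    ⟨∅, by simpa [wsum] using htot⟩
  have hle : wsum w T ≤ (3 / 4) * ∑ u, w u := hT.prop
  have hadd := wsum_add_wsum_compl w T
  refine ⟨T, le_min ?_ (by linarith)⟩
  by_contra! hlt
  have hne : Tᶜ.Nonempty := by
    by_contra hempty
    rw [Set.not_nonempty_iff_eq_empty.1 hempty] at hadd
    simp only [wsum, Set.indicator_empty, Finset.sum_const_zero] at hadd hlt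
    linarith
  obtain ⟨v, hv⟩ := hne
  have hsingle : wsum w {v} = w v := by
    classical
    simp [wsum, Set.indicator_apply]
  have hunion := wsum_union_le hw T {v}
  have hmem : wsum w (T ∪ {v}) ≤ (3 / 4) * ∑ u, w u := by linarith [hsmall v]
  exact hv (hT.le_of_ge hmem Set.subset_union_left (Or.inr rfl))

lemma PhiV_le_four [Nonempty V] (hw : ∀ v, 0 < w v)
    (hsmall : ∀ v, w v ≤ (1 / 4) * ∑ u, w u) : PhiV G w ≤ 4 := by
  obtain ⟨T, hT⟩ := exists_quarter_le_min_wsum hw hsmall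
  have htot : 0 < ∑ u, w u := Finset.sum_pos (fun v _ => hw v) Finset.univ_nonempty
  have hmin : 0 < min (wsum w T) (wsum w Tᶜ) := by linarith
  have hne : T.Nonempty := by
    rw [Set.nonempty_iff_ne_empty]
    rintro rfl
    simpa [wsum] using (lt_min_iff.1 hmin).1
  have hne' : T ≠ Set.univ := by
    rintro rfl
    simpa [wsum] using (lt_min_iff.1 hmin).2
  refine (PhiV_le_phiV hw hne hne').trans ?_
  rw [phiV, div_le_iff₀ hmin]
  have hB := wsum_mono hw (Set.subset_univ (Nin G T ∪ Nout G T))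
  have huniv : wsum w Set.univ = ∑ u, w u := by simp [wsum]
  linarith

lemma PhiV_le_five_mul_psiH [Nonempty V] (hw : ∀ v, 0 < w v)
    (hsmall : ∀ v, w v ≤ (1 / 4) * ∑ u, w u) (hS : S.Nonempty) (hS' : S ≠ Set.univ) :
    PhiV G w ≤ 5 * psiH G w S := by
  have hm := min_wsum_pos hw hS hS'
  have hM := min_wsum_le_min_wsum_union hw G S
  have hMle := min_wsum_union_le hw G S
  have hB := wsum_nonneg hw (Nin G S ∪ Nout G S)
  have hPhi : PhiV G w ≤ phiV G w S := PhiV_le_phiV hw hS hS'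
  have hfour : PhiV G w ≤ 4 := PhiV_le_four hw hsmall
  rw [phiV] at hPhi
  rw [psiH_eq]
  generalize min (wsum w S) (wsum w Sᶜ) = m at *
  generalize min (wsum w (S ∪ Nout G S)) (wsum w (Sᶜ ∪ Nin G S)) = M at *
  generalize wsum w (Nin G S ∪ Nout G S) = B at *
  have hMpos : 0 < M := hm.trans_le hM
  rcases le_total B (4 * m) with h | h
  · refine hPhi.trans ?_
    rw [← mul_div_assoc, div_le_div_iff₀ hm hMpos]
    nlinarith
  · refine hfour.trans ?_
    rw [← mul_div_assoc, le_div_iff₀ hMpos]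
    linarith

end

end VertexExpansion

/-- The optimum hypergraph conductance of the associated hypergraph is within a
factor `5` of the optimum symmetric vertex expansion:
`(1/5)·Φ^V_G ≤ ψ_H ≤ Φ^V_G`. -/
theorem PhiV_PsiH_equiv {V : Type*} [Fintype V] (G : SimpleGraph V)
    (hcard : 1 < Fintype.card V)
    (w : V → ℝ) (hw : ∀ v, 0 < w v)
    (hsmall : ∀ v, w v ≤ (1/4) * ∑ u, w u) :
    (1/5) * VertexExpansion.PhiV G w ≤ VertexExpansion.PsiH G w ∧
      VertexExpansion.PsiH G w ≤ VertexExpansion.PhiV G w := by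
  have : Nontrivial V := Fintype.one_lt_card_iff_nontrivial.1 hcard
  obtain ⟨a, b, hab⟩ := exists_pair_ne V
  have hne : ({a} : Set V) ≠ Set.univ := fun h => hab.symm (h.symm ▸ Set.mem_univ b : b ∈ {a})
  refine ⟨le_csInf ⟨_, {a}, Set.singleton_nonempty a, hne, rfl⟩ ?_,
    le_csInf ⟨_, {a}, Set.singleton_nonempty a, hne, rfl⟩ ?_⟩
  · rintro _ ⟨S, hS, hS', rfl⟩
    linarith [VertexExpansion.PhiV_le_five_mul_psiH (G := G) hw hsmall hS hS']
  · rintro _ ⟨S, hS, hS', rfl⟩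
    exact (VertexExpansion.PsiH_le_psiH hw hS hS').trans
      (VertexExpansion.psiH_le_phiV hw hS hS')
end
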